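/- There exists a subgroup G ≤ W isomorphic to the direct product C₂ × F₅ of order 40, where F₅ is the Frobenius group of order 20 (the semidirect product C₅ ⋊ C₄ with C₄ acting faithfully on C₅), such that: the action of G on the 240 exceptional classes has exactly 20 orbits, with orbit-length multiset consisting of four orbits of length 2, three of length 4, four of length 10, and nine of length 20; G is minimal; G fixes a conic class; and G satisfies condition (H1). -/

import Mathlib

open scoped BigOperators

noncomputable section

/-- The Picard lattice of a degree 1 del Pezzo surface. -/
abbrev V : Type := Fin 9 → ℤ

/-- The intersection form. -/
def bil (x y : V) : ℤ := x 0 * y 0 - ∑ i ∈ Finset.Ioi (0 : Fin 9), x i * y i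

/-- The canonical class. -/
def Kvec : V := fun i => if i = 0 then -3 else 1

abbrev LatAut := V ≃ₗ[ℤ] V

/-- The Weyl group: automorphisms preserving the form and fixing K. -/
def W : Subgroup LatAut where
  carrier := {g | (∀ x y, bil (g x) (g y) = bil x y) ∧ g Kvec = Kvec}
  one_mem' := ⟨fun _ _ => rfl, rfl⟩
  mul_mem' := by
    rintro a b ⟨ha1, ha2⟩ ⟨hb1, hb2⟩
    refine ⟨fun x y => ?_, ?_⟩
    · show bil (a (b x)) (a (b y)) = bil x y
      rw [ha1, hb1]
    · show a (b Kvec) = Kvec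
      rw [hb2, ha2]
  inv_mem' := by
    rintro a ⟨ha1, ha2⟩
    refine ⟨fun x y => ?_, ?_⟩
    · have h := ha1 (a⁻¹ x) (a⁻¹ y)
      have hx : a (a⁻¹ x) = x := a.apply_symm_apply x
      have hy : a (a⁻¹ y) = y := a.apply_symm_apply y
      rw [hx, hy] at h
      exact h.symm
    · have h2 : a.symm (a Kvec) = a.symm Kvec := by rw [ha2]
      rw [a.symm_apply_apply] at h2
      exact (show a⁻¹ Kvec = a.symm Kvec from rfl).trans h2.symm

/-- Exceptional classes. -/
def Exc : Set V := {E | bil E E = -1 ∧ bil E Kvec = -1}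

/-- Conic classes. -/
def IsConic (C : V) : Prop := bil C C = 0 ∧ bil C Kvec = -2

/-- The orbit of a vector under a subgroup of `LatAut`. -/
def orb (G : Subgroup LatAut) (E : V) : Set V := {v | ∃ g ∈ G, g E = v}

/-- The set of orbits of exceptional classes. -/
def orbs (G : Subgroup LatAut) : Set (Set V) := {S | ∃ E ∈ Exc, S = orb G E}

/-- The stabilizer of a vector, as a subgroup of `LatAut`. -/
def stab (G : Subgroup LatAut) (E : V) : Subgroup LatAut where
  carrier := {g | g ∈ G ∧ g E = E}
  one_mem' := ⟨G.one_mem, rfl⟩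
  mul_mem' := by
    rintro a b ⟨haG, ha⟩ ⟨hbG, hb⟩
    exact ⟨G.mul_mem haG hbG, by show a (b E) = E; rw [hb, ha]⟩
  inv_mem' := by
    rintro a ⟨haG, ha⟩
    refine ⟨G.inv_mem haG, ?_⟩
    conv_lhs => rw [← ha]
    exact a.symm_apply_apply E

/-- `G` is minimal: no nonempty orbit of exceptional classes consists of pairwise
orthogonal classes. -/
def MinimalAction (G : Subgroup LatAut) : Prop :=
  ∀ E ∈ Exc, ¬ (∀ E₁ ∈ orb G E, ∀ E₂ ∈ orb G E, E₁ ≠ E₂ → bil E₁ E₂ = 0)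

/-- The natural representation of a subgroup of `LatAut` on the lattice. -/
def rep (G : Subgroup LatAut) : Representation ℤ G V where
  toFun g := (g : LatAut).toLinearMap
  map_one' := rfl
  map_mul' _ _ := rfl

/-- Condition (H1): the first group cohomology of every subgroup of `G`
with coefficients in the lattice vanishes. -/
def CondH1 (G : Subgroup LatAut) : Prop :=
  ∀ G' : Subgroup LatAut, G' ≤ G →
    Subsingleton (groupCohomology.H1 (Rep.of (rep G')))

theorem bil_eq (x y : V) : bil x y = x 0 * y 0 - (x 1 * y 1 + x 2 * y 2 + x 3 * y 3 + x 4 * y 4 +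
    x 5 * y 5 + x 6 * y 6 + x 7 * y 7 + x 8 * y 8) := by
  simp [bil, Fin.sum_univ_succ]
  ring

theorem bil_add_right (x y z : V) : bil x (y + z) = bil x y + bil x z := by
  simp only [bil_eq, Pi.add_apply]
  ring

/-! ### Vanishing of first cohomology -/

/-- A lattice with a dual pair of families permuted by a finite group, whose associated
endomorphism is the identity, is a direct summand of a permutation module; its first cohomology
vanishes. -/
theorem subsingleton_H1_of_permuted_families {Γ M ι : Type} [Group Γ] [Finite Γ] [AddCommGroup M]
    [Fintype ι] (ρ : Representation ℤ Γ M) (w : ι → M →+ ℤ) (v : ι → M)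
    (hperm : ∀ g, ∃ e : Equiv.Perm ι, ∀ i, (∀ x, w (e i) (ρ g x) = w i x) ∧ v (e i) = ρ g (v i))
    (hid : ∀ x, ∑ i, w i x • v i = x) :
    Subsingleton (groupCohomology.H1 (Rep.of ρ)) := by
  have := Fintype.ofFinite Γ
  refine subsingleton_of_forall_eq 0 fun y => ?_
  induction y using groupCohomology.H1_induction_on with
  | h f =>
  rw [groupCohomology.H1π_eq_zero_iff]
  have hf : ∀ g h : Γ, f (g * h) = ρ g (f h) + f g := (groupCohomology.mem_cocycles₁_iff _).1 f.2
  let N : ι → ℤ := fun i => ∑ h : Γ, w i (f h)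
  let n : ℤ := Fintype.card Γ
  have hn : n ≠ 0 := by simp [n]
  refine ⟨-∑ i, (N i / n) • v i, funext fun g => ?_⟩
  obtain ⟨e, he⟩ := hperm g
  have key (i : ι) : w (e i) (f g) = N (e i) / n - N i / n := by
    have h1 : N (e i) = N i + w (e i) (f g) * n := by
      calc N (e i) = ∑ h : Γ, w (e i) (f (g * h)) :=
            (Fintype.sum_equiv (Equiv.mulLeft g) _ _ fun _ => rfl).symm
        _ = ∑ h : Γ, (w i (f h) + w (e i) (f g)) := by
            refine Finset.sum_congr rfl fun h _ => ?_
            rw [hf, map_add, (he i).1]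
        _ = N i + w (e i) (f g) * n := by
            rw [Finset.sum_add_distrib]
            simp [N, n, mul_comm]
    rw [h1, Int.add_mul_ediv_right _ _ hn]
    ring
  change ρ g (-∑ i, (N i / n) • v i) - -∑ i, (N i / n) • v i = f g
  have h2 : f g = ∑ i, (N (e i) / n - N i / n) • v (e i) := by
    rw [← hid (f g), ← Equiv.sum_comp e]
    exact Finset.sum_congr rfl fun i _ => by rw [key]
  have h3 : ρ g (∑ i, (N i / n) • v i) = ∑ i, (N i / n) • v (e i) := by
    simp only [map_sum, map_zsmul, (he _).2]
  rw [map_neg, h3, h2, ← Equiv.sum_comp e fun i => (N i / n) • v i]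
  simp only [sub_smul, Finset.sum_sub_distrib]
  abel

/-! ### The generators -/

/-- The generator of order five, permuting `E₂, …, E₆` cyclically. -/
def genA : LatAut where
  toFun x := ![x 0, x 1, x 6, x 2, x 3, x 4, x 5, x 7, x 8]
  invFun x := ![x 0, x 1, x 3, x 4, x 5, x 6, x 2, x 7, x 8]
  map_add' x y := by ext i; fin_cases i <;> rfl
  map_smul' r x := by ext i; fin_cases i <;> rfl
  left_inv x := by ext i; fin_cases i <;> rfl
  right_inv x := by ext i; fin_cases i <;> rfl

/-- The generator of order four: with `F` the class of a fibre of the conic bundle, it sends `Eᵢ`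
to `F - E_σ(i)` for `2 ≤ i ≤ 6`, where `σ = (3 4 6 5)`, fixes `E₇` and sends `E₈` to `F - E₈`. -/
def genC : LatAut where
  toFun x := ![4 * x 0 + 3 * x 1 + x 2 + x 3 + x 4 + x 5 + x 6 + x 8,
    -3 * x 0 - 2 * x 1 - x 2 - x 3 - x 4 - x 5 - x 6 - x 8,
    -x 0 - x 1 - x 2, -x 0 - x 1 - x 5, -x 0 - x 1 - x 3, -x 0 - x 1 - x 6, -x 0 - x 1 - x 4,
    x 7, -x 0 - x 1 - x 8]
  invFun x := ![4 * x 0 + 3 * x 1 + x 2 + x 3 + x 4 + x 5 + x 6 + x 8,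
    -3 * x 0 - 2 * x 1 - x 2 - x 3 - x 4 - x 5 - x 6 - x 8,
    -x 0 - x 1 - x 2, -x 0 - x 1 - x 4, -x 0 - x 1 - x 6, -x 0 - x 1 - x 3, -x 0 - x 1 - x 5,
    x 7, -x 0 - x 1 - x 8]
  map_add' x y := by ext i; fin_cases i <;> simp <;> ring
  map_smul' r x := by ext i; fin_cases i <;> simp <;> ring
  left_inv x := by ext i; fin_cases i <;> simp <;> ring
  right_inv x := by ext i; fin_cases i <;> simp <;> ring

/-- The central involution, interchanging the components of the singular fibres through
`E₇` and `E₈`. -/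
def genZ : LatAut where
  toFun x := ![2 * x 0 + x 1 + x 7 + x 8, -x 0 - x 7 - x 8, x 2, x 3, x 4, x 5, x 6,
    -x 0 - x 1 - x 7, -x 0 - x 1 - x 8]
  invFun x := ![2 * x 0 + x 1 + x 7 + x 8, -x 0 - x 7 - x 8, x 2, x 3, x 4, x 5, x 6,
    -x 0 - x 1 - x 7, -x 0 - x 1 - x 8]
  map_add' x y := by ext i; fin_cases i <;> simp <;> ring
  map_smul' r x := by ext i; fin_cases i <;> simp <;> ring
  left_inv x := by ext i; fin_cases i <;> simp <;> ring
  right_inv x := by ext i; fin_cases i <;> simp <;> ring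

theorem genA_apply (x : V) : genA x = ![x 0, x 1, x 6, x 2, x 3, x 4, x 5, x 7, x 8] := rfl

theorem genC_apply (x : V) : genC x =
    ![4 * x 0 + 3 * x 1 + x 2 + x 3 + x 4 + x 5 + x 6 + x 8,
      -3 * x 0 - 2 * x 1 - x 2 - x 3 - x 4 - x 5 - x 6 - x 8,
      -x 0 - x 1 - x 2, -x 0 - x 1 - x 5, -x 0 - x 1 - x 3, -x 0 - x 1 - x 6, -x 0 - x 1 - x 4,
      x 7, -x 0 - x 1 - x 8] := rfl

theorem genZ_apply (x : V) : genZ x =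
    ![2 * x 0 + x 1 + x 7 + x 8, -x 0 - x 7 - x 8, x 2, x 3, x 4, x 5, x 6,
      -x 0 - x 1 - x 7, -x 0 - x 1 - x 8] := rfl

theorem genA_pow_five : genA ^ 5 = 1 := by
  ext x i
  simp only [pow_succ, pow_zero, one_mul, LinearEquiv.mul_apply, LinearEquiv.coe_one, id,
    genA_apply]
  fin_cases i <;> rfl

theorem genC_pow_four : genC ^ 4 = 1 := by
  ext x i
  simp only [pow_succ, pow_zero, one_mul, LinearEquiv.mul_apply, LinearEquiv.coe_one, id,
    genC_apply]
  fin_cases i <;> simp <;> ring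

theorem genZ_pow_two : genZ ^ 2 = 1 := by
  ext x i
  simp only [pow_succ, pow_zero, one_mul, LinearEquiv.mul_apply, LinearEquiv.coe_one, id,
    genZ_apply]
  fin_cases i <;> simp <;> ring

theorem genC_mul_genA : genC * genA = genA ^ 2 * genC := by
  ext x i
  simp only [pow_succ, pow_zero, one_mul, LinearEquiv.mul_apply, genA_apply, genC_apply]
  fin_cases i <;> simp <;> ring

theorem genZ_mul_genA : genZ * genA = genA * genZ := by
  ext x i
  simp only [LinearEquiv.mul_apply, genA_apply, genZ_apply]
  fin_cases i <;> simp

theorem genZ_mul_genC : genZ * genC = genC * genZ := by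
  ext x i
  simp only [LinearEquiv.mul_apply, genC_apply, genZ_apply]
  fin_cases i <;> simp <;> ring

theorem genA_mem_W : genA ∈ W := by
  refine ⟨fun x y => ?_, ?_⟩
  · simp only [bil_eq, genA_apply]
    simp
    ring
  · ext i
    fin_cases i <;> rfl

theorem genC_mem_W : genC ∈ W := by
  refine ⟨fun x y => ?_, ?_⟩
  · simp only [bil_eq, genC_apply]
    simp
    ring
  · ext i
    fin_cases i <;> simp [genC_apply, Kvec]

theorem genZ_mem_W : genZ ∈ W := by
  refine ⟨fun x y => ?_, ?_⟩
  · simp only [bil_eq, genZ_apply]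
    simp
    ring
  · ext i
    fin_cases i <;> simp [genZ_apply, Kvec]

/-! ### The group -/

/-- The homomorphism from `ℤ/n` sending the generator to `h`. -/
def zmodPowHom {H : Type*} [Group H] (n : ℕ) [NeZero n] (h : H) (hn : h ^ n = 1) :
    Multiplicative (ZMod n) →* H where
  toFun k := h ^ k.toAdd.val
  map_one' := by simp
  map_mul' a b := by rw [toAdd_mul, ZMod.val_add, ← pow_add, ← pow_eq_pow_mod _ hn]

/-- The action of `ℤ/4` on `ℤ/5` by powers of two. -/
def frobeniusAction : Multiplicative (ZMod 4) →* MulAut (Multiplicative (ZMod 5)) where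
  toFun k :=
    { toFun := fun m => m ^ 2 ^ k.toAdd.val
      invFun := fun m => m ^ 3 ^ k.toAdd.val
      left_inv := by revert k; decide
      right_inv := by revert k; decide
      map_mul' := fun a b => mul_pow a b _ }
  map_one' := by ext m; simp
  map_mul' a b := by
    ext m
    change m ^ 2 ^ (a * b).toAdd.val = (m ^ 2 ^ b.toAdd.val) ^ 2 ^ a.toAdd.val
    revert a b m
    decide

theorem frobeniusAction_injective : Function.Injective frobeniusAction := by
  intro a b h
  have h1 : (Multiplicative.ofAdd (1 : ZMod 5)) ^ 2 ^ a.toAdd.val =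
      (Multiplicative.ofAdd (1 : ZMod 5)) ^ 2 ^ b.toAdd.val :=
    DFunLike.congr_fun h (Multiplicative.ofAdd (1 : ZMod 5))
  revert a b
  decide

/-- The group `C₂ × F₅`. -/
abbrev C2F5 : Type :=
  Multiplicative (ZMod 2) × (Multiplicative (ZMod 5) ⋊[frobeniusAction] Multiplicative (ZMod 4))

/-- The action of `F₅` on the lattice. -/
def frobeniusHom : Multiplicative (ZMod 5) ⋊[frobeniusAction] Multiplicative (ZMod 4) →* LatAut :=
  SemidirectProduct.lift (zmodPowHom 5 genA genA_pow_five) (zmodPowHom 4 genC genC_pow_four) <| by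
    intro k
    refine MonoidHom.ext fun m => ?_
    change genA ^ (m ^ 2 ^ k.toAdd.val).toAdd.val =
      genC ^ k.toAdd.val * genA ^ m.toAdd.val * (genC ^ k.toAdd.val)⁻¹
    have hpow (i : ℕ) : SemiconjBy (genC ^ i) genA (genA ^ 2 ^ i) := by
      induction i with
      | zero => simp
      | succ i ih =>
        rw [pow_succ, pow_succ', pow_mul]
        have := ih.pow_right 2
        rw [← pow_mul, mul_comm, pow_mul] at this
        exact this.mul_left genC_mul_genA
    rw [((hpow k.toAdd.val).pow_right m.toAdd.val).eq, mul_inv_cancel_right, ← pow_mul,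
      pow_eq_pow_mod (2 ^ _ * _) genA_pow_five]
    congr 1
    revert k m
    decide

/-- The action of `C₂ × F₅` on the lattice. -/
def c2f5Hom : C2F5 →* LatAut :=
  (zmodPowHom 2 genZ genZ_pow_two).noncommCoprod frobeniusHom fun _ _ =>
    Commute.mul_right
      ((show Commute genZ genA from genZ_mul_genA).pow_pow _ _)
      ((show Commute genZ genC from genZ_mul_genC).pow_pow _ _)

theorem c2f5Hom_apply (t : C2F5) : c2f5Hom t =
    genZ ^ t.1.toAdd.val * (genA ^ t.2.left.toAdd.val * genC ^ t.2.right.toAdd.val) := rfl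

/-- The image of `C₂ × F₅` in the Weyl group. -/
def dpGroup : Subgroup LatAut := c2f5Hom.range

theorem mem_dpGroup {g : LatAut} : g ∈ dpGroup ↔
    ∃ i < 2, ∃ j < 5, ∃ k < 4, g = genZ ^ i * (genA ^ j * genC ^ k) := by
  constructor
  · rintro ⟨t, rfl⟩
    exact ⟨_, ZMod.val_lt t.1.toAdd, _, ZMod.val_lt t.2.left.toAdd, _,
      ZMod.val_lt t.2.right.toAdd, c2f5Hom_apply t⟩
  · rintro ⟨i, hi, j, hj, k, hk, rfl⟩
    refine ⟨(.ofAdd (i : ZMod 2), ⟨.ofAdd (j : ZMod 5), .ofAdd (k : ZMod 4)⟩), ?_⟩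
    rw [c2f5Hom_apply]
    simp only [toAdd_ofAdd, ZMod.val_cast_of_lt hi, ZMod.val_cast_of_lt hj,
      ZMod.val_cast_of_lt hk]

theorem dpGroup_le_of_gens (M : Submonoid LatAut) (hA : genA ∈ M) (hC : genC ∈ M)
    (hZ : genZ ∈ M) {g : LatAut} (hg : g ∈ dpGroup) : g ∈ M := by
  obtain ⟨i, -, j, -, k, -, rfl⟩ := mem_dpGroup.1 hg
  exact M.mul_mem (M.pow_mem hZ i) (M.mul_mem (M.pow_mem hA j) (M.pow_mem hC k))

theorem dpGroup_le_W : dpGroup ≤ W := fun _ hg =>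
  dpGroup_le_of_gens W.toSubmonoid genA_mem_W genC_mem_W genZ_mem_W hg

instance : Finite C2F5 :=
  Finite.of_injective (fun t => (t.1, t.2.left, t.2.right)) fun s t h => by
    simp only [Prod.mk.injEq] at h
    exact Prod.ext h.1 (SemidirectProduct.ext h.2.1 h.2.2)

instance : Finite dpGroup := Finite.of_surjective _ c2f5Hom.rangeRestrict_surjective

/-! ### Explicit coordinates -/

/-- Coordinate vectors, in a form suited to evaluation. -/
abbrev Coords : Type := ℤ × ℤ × ℤ × ℤ × ℤ × ℤ × ℤ × ℤ × ℤ

instance : DecidableEq Coords :=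
  @instDecidableEqProd _ _ _ <| @instDecidableEqProd _ _ _ <| @instDecidableEqProd _ _ _ <|
    @instDecidableEqProd _ _ _ instDecidableEqProd

/-- The lattice vector with given coordinates. -/
def ofCoords : Coords → V
  | (a, b, c, d, e, f, g, h, i) => ![a, b, c, d, e, f, g, h, i]

theorem ofCoords_injective : Function.Injective ofCoords := by
  rintro ⟨a, b, c, d, e, f, g, h, i⟩ ⟨a₁, b₁, c₁, d₁, e₁, f₁, g₁, h₁, i₁⟩ H
  have h0 := congrFun H 0
  have h1 := congrFun H 1
  have h2 := congrFun H 2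
  have h3 := congrFun H 3
  have h4 := congrFun H 4
  have h5 := congrFun H 5
  have h6 := congrFun H 6
  have h7 := congrFun H 7
  have h8 := congrFun H 8
  simp only [ofCoords] at h0 h1 h2 h3 h4 h5 h6 h7 h8
  simp_all

/-- `genA` in coordinates. -/
def coordsA : Coords → Coords
  | (a, b, c, d, e, f, g, h, i) => (a, b, g, c, d, e, f, h, i)

/-- `genC` in coordinates. -/
def coordsC : Coords → Coords
  | (a, b, c, d, e, f, g, h, i) =>
    (4 * a + 3 * b + c + d + e + f + g + i, -3 * a - 2 * b - c - d - e - f - g - i,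
      -a - b - c, -a - b - f, -a - b - d, -a - b - g, -a - b - e, h, -a - b - i)

/-- `genZ` in coordinates. -/
def coordsZ : Coords → Coords
  | (a, b, c, d, e, f, g, h, i) =>
    (2 * a + b + h + i, -a - h - i, c, d, e, f, g, -a - b - h, -a - b - i)

theorem pow_ofCoords {g : LatAut} {f : Coords → Coords} (h : ∀ p, g (ofCoords p) = ofCoords (f p))
    (n : ℕ) (p : Coords) : (g ^ n) (ofCoords p) = ofCoords (f^[n] p) := by
  induction n generalizing p with
  | zero => rfl
  | succ n ih => rw [pow_succ, LinearEquiv.mul_apply, h, ih, Function.iterate_succ_apply]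

theorem word_ofCoords (i j k : ℕ) (p : Coords) :
    (genZ ^ i * (genA ^ j * genC ^ k)) (ofCoords p) =
      ofCoords (coordsZ^[i] (coordsA^[j] (coordsC^[k] p))) := by
  rw [LinearEquiv.mul_apply, LinearEquiv.mul_apply, pow_ofCoords (f := coordsC) fun _ => rfl,
    pow_ofCoords (f := coordsA) fun _ => rfl, pow_ofCoords (f := coordsZ) fun _ => rfl]

/-- The orbit of a coordinate vector, with repetitions. -/
def orbitList (p : Coords) : List Coords :=
  (List.range 4).flatMap fun k => (List.range 5).flatMap fun j => (List.range 2).map fun i =>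
    coordsZ^[i] (coordsA^[j] (coordsC^[k] p))

theorem orb_ofCoords (p : Coords) :
    orb dpGroup (ofCoords p) = ((orbitList p).toFinset.image ofCoords : Finset V) := by
  ext v
  simp only [orb, mem_dpGroup, orbitList, Finset.coe_image, Set.mem_image, Finset.mem_coe,
    List.mem_toFinset, List.mem_flatMap, List.mem_map, List.mem_range, Set.mem_ofPred_eq]
  constructor
  · rintro ⟨_, ⟨i, hi, j, hj, k, hk, rfl⟩, rfl⟩
    exact ⟨_, ⟨k, hk, j, hj, i, hi, rfl⟩, (word_ofCoords i j k p).symm⟩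
  · rintro ⟨_, ⟨k, hk, j, hj, i, hi, rfl⟩, rfl⟩
    exact ⟨_, ⟨i, hi, j, hj, k, hk, rfl⟩, word_ofCoords i j k p⟩

theorem c2f5Hom_injective : Function.Injective c2f5Hom := by
  refine (injective_iff_map_eq_one _).2 fun ⟨i, j, k⟩ h => ?_
  have h1 := LinearEquiv.congr_fun h (ofCoords (1, 2, 3, 4, 5, 6, 7, 8, 10))
  rw [c2f5Hom_apply, word_ofCoords] at h1
  have h2 : _ = ((1, 2, 3, 4, 5, 6, 7, 8, 10) : Coords) := ofCoords_injective h1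
  have h3 : i = 1 ∧ j = 1 ∧ k = 1 := by
    clear h h1
    revert i j k
    decide +kernel
  obtain ⟨rfl, rfl, rfl⟩ := h3
  rfl

/-! ### Enumeration of the exceptional classes -/

/-- Integer vectors of length `n` with entries in `[-7, 7]`, given sum and given sum of squares. -/
def sumSqList : ℕ → ℤ → ℤ → List (List ℤ)
  | 0, s, q => if s = 0 ∧ q = 0 then [[]] else []
  | n + 1, s, q =>
    if s ^ 2 ≤ (n + 1) * q then
      [-7, -6, -5, -4, -3, -2, -1, 0, 1, 2, 3, 4, 5, 6, 7].flatMap fun a =>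
        (sumSqList n (s - a) (q - a ^ 2)).map (a :: ·)
    else []

theorem sq_sum_le (l : List ℤ) : l.sum ^ 2 ≤ l.length * (l.map (· ^ 2)).sum := by
  have h := sq_sum_le_card_mul_sum_sq (s := Finset.univ) (f := fun i : Fin l.length => l[i])
  simpa [Fin.sum_univ_getElem, Fin.sum_univ_fun_getElem l (· ^ 2)] using h

theorem mem_sumSqList (l : List ℤ) (h : (l.map (· ^ 2)).sum < 64) :
    l ∈ sumSqList l.length l.sum (l.map (· ^ 2)).sum := by
  induction l with
  | nil => simp [sumSqList]
  | cons a l ih =>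
    have hcs := sq_sum_le (a :: l)
    simp only [List.map_cons, List.sum_cons, List.length_cons] at h hcs ⊢
    have hl : 0 ≤ (l.map (· ^ 2)).sum := List.sum_nonneg (by simp +contextual [sq_nonneg])
    have ha : a ∈ [-7, -6, -5, -4, -3, -2, -1, 0, 1, 2, 3, 4, 5, 6, 7] := by
      have h1 : -8 < a := by nlinarith
      have h2 : a < 8 := by nlinarith
      interval_cases a <;> simp
    push_cast at hcs
    rw [sumSqList, if_pos hcs, List.mem_flatMap]
    refine ⟨a, ha, List.mem_map_of_mem ?_⟩
    rw [add_sub_cancel_left, add_sub_cancel_left]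
    exact ih (by nlinarith [sq_nonneg a])

/-- The coordinate lists of the exceptional classes. -/
def excList : List (List ℤ) :=
  [-1, 0, 1, 2, 3, 4, 5, 6, 7].flatMap fun a =>
    (sumSqList 8 (1 - 3 * a) (a ^ 2 + 1)).map (a :: ·)

theorem length_excList : excList.length = 240 := by
  decide +kernel

theorem ofFn_mem_excList {E : V} (hE : E ∈ Exc) : List.ofFn E ∈ excList := by
  obtain ⟨h1, h2⟩ := hE
  rw [bil_eq] at h1 h2
  have hs : (List.ofFn fun i : Fin 8 => E i.succ).sum = 1 - 3 * E 0 := by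
    simp [Kvec] at h2
    simp
    linarith
  have hq : ((List.ofFn fun i : Fin 8 => E i.succ).map (· ^ 2)).sum = E 0 ^ 2 + 1 := by
    simp
    linarith
  have hcs := sq_sum_le (List.ofFn fun i : Fin 8 => E i.succ)
  have hmem := mem_sumSqList (List.ofFn fun i : Fin 8 => E i.succ)
  rw [List.length_ofFn, hs, hq] at hcs hmem
  push_cast at hcs
  have hlo : -1 ≤ E 0 := by nlinarith
  have hhi : E 0 ≤ 7 := by nlinarith
  have hmem := hmem (by nlinarith)
  rw [List.ofFn_succ, excList, List.mem_flatMap]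
  refine ⟨E 0, ?_, List.mem_map_of_mem hmem⟩
  clear * - hlo hhi
  simp only [List.mem_cons, List.not_mem_nil]
  omega

theorem ncard_exc_le : Exc.Finite ∧ Exc.ncard ≤ 240 := by
  have hsub : List.ofFn '' Exc ⊆ (excList.toFinset : Set (List ℤ)) := by
    rintro _ ⟨E, hE, rfl⟩
    exact List.mem_toFinset.2 (ofFn_mem_excList hE)
  have hinj : Set.InjOn (List.ofFn : V → List ℤ) Exc := List.ofFn_injective.injOn
  refine ⟨.of_finite_image (excList.toFinset.finite_toSet.subset hsub) hinj, ?_⟩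
  rw [← hinj.ncard_image, ← length_excList]
  refine (Set.ncard_le_ncard hsub).trans ?_
  rw [Set.ncard_coe_finset]
  exact List.toFinset_card_le _

/-! ### The orbits on exceptional classes -/

/-- Representatives of the orbits of exceptional classes. -/
def orbitRep : Fin 20 → Coords :=
  ![(0, 0, 0, 0, 0, 0, 0, 0, 1),
    (0, 0, 0, 0, 0, 0, 0, 1, 0),
    (5, -1, -2, -2, -2, -2, -2, -2, -1),
    (5, -1, -2, -2, -2, -2, -2, -1, -2),
    (0, 1, 0, 0, 0, 0, 0, 0, 0),
    (2, 0, -1, -1, -1, -1, -1, 0, 0),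
    (3, 0, -1, -1, -1, -1, -1, -1, -2),
    (0, 0, 1, 0, 0, 0, 0, 0, 0),
    (2, 0, 0, 0, -1, -1, -1, -1, -1),
    (2, 0, 0, -1, 0, -1, -1, -1, -1),
    (5, -1, -1, -2, -2, -2, -2, -2, -2),
    (1, 0, 0, 0, 0, -1, -1, 0, 0),
    (1, 0, 0, 0, -1, 0, -1, 0, 0),
    (1, 0, 0, 0, 0, 0, -1, 0, -1),
    (2, 0, 0, -1, -1, -1, -1, -1, 0),
    (2, 0, 0, -1, -1, -1, -1, 0, -1),
    (3, -1, 0, -1, -1, -1, -2, -1, -1),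
    (3, 0, -1, -1, -1, -1, -2, -1, -1),
    (4, -1, -1, -1, -2, -1, -2, -1, -2),
    (4, -1, -1, -1, -1, -2, -2, -1, -2)]

/-- The lengths of the orbits of exceptional classes. -/
def orbitLength : Fin 20 → ℕ :=
  ![2, 2, 2, 2, 4, 4, 4, 10, 10, 10, 10, 20, 20, 20, 20, 20, 20, 20, 20, 20]

/-- The orbits of exceptional classes. -/
def excOrbit (i : Fin 20) : Set V := orb dpGroup (ofCoords (orbitRep i))

theorem card_orbitList (i : Fin 20) : (orbitList (orbitRep i)).toFinset.card = orbitLength i := by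
  revert i
  decide +kernel

theorem ncard_excOrbit (i : Fin 20) : (excOrbit i).ncard = orbitLength i := by
  rw [excOrbit, orb_ofCoords, Set.ncard_coe_finset,
    Finset.card_image_of_injective _ ofCoords_injective, card_orbitList]

theorem eq_of_orbitRep_mem_orbitList {i j : Fin 20} (h : orbitRep i ∈ orbitList (orbitRep j)) :
    i = j := by
  revert i j
  decide +kernel

theorem orb_eq_of_mem {G : Subgroup LatAut} {x y : V} (h : x ∈ orb G y) : orb G x = orb G y := by
  obtain ⟨g, hg, rfl⟩ := h
  ext v
  constructor
  · rintro ⟨k, hk, rfl⟩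
    exact ⟨k * g, G.mul_mem hk hg, rfl⟩
  · rintro ⟨k, hk, rfl⟩
    refine ⟨k * g⁻¹, G.mul_mem hk (G.inv_mem hg), ?_⟩
    rw [← LinearEquiv.mul_apply, inv_mul_cancel_right]

theorem self_mem_orb (G : Subgroup LatAut) (x : V) : x ∈ orb G x := ⟨1, G.one_mem, rfl⟩

theorem excOrbit_eq_of_mem {i j : Fin 20} {x : V} (hi : x ∈ excOrbit i) (hj : x ∈ excOrbit j) :
    i = j := by
  have h : ofCoords (orbitRep i) ∈ orb dpGroup (ofCoords (orbitRep j)) := by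
    rw [← orb_eq_of_mem hj, orb_eq_of_mem hi]
    exact self_mem_orb _ _
  rw [orb_ofCoords, Finset.mem_coe, Finset.mem_image] at h
  obtain ⟨p, hp, hpi⟩ := h
  rw [ofCoords_injective hpi, List.mem_toFinset] at hp
  exact eq_of_orbitRep_mem_orbitList hp

theorem excOrbit_injective : Function.Injective excOrbit := fun i _ h =>
  excOrbit_eq_of_mem (x := ofCoords (orbitRep i)) (self_mem_orb _ _) (h ▸ self_mem_orb _ _)

theorem orb_subset_exc {G : Subgroup LatAut} (hG : G ≤ W) {E : V} (hE : E ∈ Exc) :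
    orb G E ⊆ Exc := by
  rintro _ ⟨g, hg, rfl⟩
  obtain ⟨hg1, hg2⟩ := hG hg
  refine ⟨(hg1 E E).trans hE.1, ?_⟩
  rw [← hE.2, ← hg1 E Kvec, hg2]

theorem ofCoords_orbitRep_mem_exc (i : Fin 20) : ofCoords (orbitRep i) ∈ Exc := by
  simp only [Exc, Set.mem_ofPred_eq, bil_eq]
  revert i
  decide +kernel

theorem iUnion_excOrbit : ⋃ i, excOrbit i = Exc := by
  obtain ⟨hfin, hcard⟩ := ncard_exc_le
  have hsub (i : Fin 20) : excOrbit i ⊆ Exc :=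
    orb_subset_exc dpGroup_le_W (ofCoords_orbitRep_mem_exc i)
  refine Set.eq_of_subset_of_ncard_le (Set.iUnion_subset hsub) (hcard.trans ?_) hfin
  have hdisj : Pairwise (Function.onFun Disjoint excOrbit) := fun i j hij =>
    Set.disjoint_left.2 fun _ hi hj => hij (excOrbit_eq_of_mem hi hj)
  rw [Set.ncard_iUnion_of_finite (fun i => hfin.subset (hsub i)) hdisj, finsum_eq_sum_of_fintype]
  simp only [ncard_excOrbit]
  decide

theorem orbs_dpGroup : orbs dpGroup = Set.range excOrbit := by
  ext S
  constructor
  · rintro ⟨E, hE, rfl⟩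
    rw [← iUnion_excOrbit] at hE
    obtain ⟨i, hi⟩ := Set.mem_iUnion.1 hE
    exact ⟨i, (orb_eq_of_mem hi).symm⟩
  · rintro ⟨i, rfl⟩
    exact ⟨_, ofCoords_orbitRep_mem_exc i, rfl⟩

theorem ncard_orbs_dpGroup : (orbs dpGroup).ncard = 20 := by
  rw [orbs_dpGroup, Set.ncard_range_of_injective excOrbit_injective, Nat.card_fin]

theorem ncard_orbs_of_length (k : ℕ) : {S ∈ orbs dpGroup | S.ncard = k}.ncard =
    (Finset.univ.filter fun i => orbitLength i = k).card := by
  rw [← Set.ncard_coe_finset, ← Set.ncard_image_of_injective _ excOrbit_injective, orbs_dpGroup]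
  congr 1
  ext S
  constructor
  · rintro ⟨⟨i, rfl⟩, hk⟩
    exact ⟨i, by simpa [ncard_excOrbit] using hk, rfl⟩
  · rintro ⟨i, hi, rfl⟩
    exact ⟨⟨i, rfl⟩, by simpa [ncard_excOrbit] using hi⟩

theorem exists_orbitList_bil_ne_zero (i : Fin 20) : ∃ p ∈ orbitList (orbitRep i),
    orbitRep i ≠ p ∧ bil (ofCoords (orbitRep i)) (ofCoords p) ≠ 0 := by
  simp only [bil_eq]
  revert i
  decide +kernel

theorem minimalAction_dpGroup : MinimalAction dpGroup := by
  intro E hE H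
  rw [← iUnion_excOrbit] at hE
  obtain ⟨i, hi⟩ := Set.mem_iUnion.1 hE
  obtain ⟨p, hp, hne, hbil⟩ := exists_orbitList_bil_ne_zero i
  rw [orb_eq_of_mem hi] at H
  refine hbil (H _ (self_mem_orb _ _) _ ?_ (ofCoords_injective.ne hne))
  rw [orb_ofCoords]
  exact Finset.mem_coe.2 (Finset.mem_image_of_mem _ (List.mem_toFinset.2 hp))

/-! ### The conic class -/

theorem exists_conic_fixed : ∃ C, IsConic C ∧ ∀ g ∈ dpGroup, g C = C := by
  refine ⟨ofCoords (1, -1, 0, 0, 0, 0, 0, 0, 0), ⟨by simp [bil_eq, ofCoords],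
    by simp [bil_eq, ofCoords, Kvec]⟩, fun g hg => ?_⟩
  refine dpGroup_le_of_gens (MulAction.stabilizerSubmonoid LatAut (ofCoords _)) ?_ ?_ ?_ hg
  all_goals
    ext i
    fin_cases i <;> rfl

/-! ### Cohomology of the lattice -/

/-- A family of lattice vectors permuted by the group. -/
def dualFamily : Fin 15 → Coords :=
  ![(-2, 0, 1, 1, 1, 1, 1, 1, 1), (1, 0, 0, 0, 0, 0, 0, 0, 0), (2, -1, 0, 0, 0, 0, 0, -1, -1),
    (4, -3, -1, -1, -1, -1, -1, -1, 0), (4, -3, -1, -1, -1, -1, -1, 0, -1),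
    (0, 0, 1, 0, 0, 0, 0, 0, 0), (0, 0, 0, 1, 0, 0, 0, 0, 0), (0, 0, 0, 0, 1, 0, 0, 0, 0),
    (0, 0, 0, 0, 0, 1, 0, 0, 0), (0, 0, 0, 0, 0, 0, 1, 0, 0),
    (1, -1, -1, 0, 0, 0, 0, 0, 0), (1, -1, 0, -1, 0, 0, 0, 0, 0), (1, -1, 0, 0, -1, 0, 0, 0, 0),
    (1, -1, 0, 0, 0, -1, 0, 0, 0), (1, -1, 0, 0, 0, 0, -1, 0, 0)]

/-- A family of lattice vectors permuted by the group in the same way as `dualFamily`, and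
splitting the resulting map to a permutation module. -/
def splitFamily : Fin 15 → Coords :=
  ![(5, 1, -3, -3, -3, -3, -3, -3, -3), (2, 1, -1, -1, -1, -1, -1, -2, -2),
    (1, 2, -1, -1, -1, -1, -1, -1, -1), (4, -1, -2, -2, -2, -2, -2, -1, -2),
    (4, -1, -2, -2, -2, -2, -2, -2, -1),
    (-2, -2, 1, 2, 1, 1, 2, 2, 2), (-2, -2, 2, 1, 2, 1, 1, 2, 2), (-2, -2, 1, 2, 1, 2, 1, 2, 2),
    (-2, -2, 1, 1, 2, 1, 2, 2, 2), (-2, -2, 2, 1, 1, 2, 1, 2, 2),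
    (-5, 1, 3, 3, 2, 2, 3, 2, 2), (-5, 1, 3, 3, 3, 2, 2, 2, 2), (-5, 1, 2, 3, 3, 3, 2, 2, 2),
    (-5, 1, 2, 2, 3, 3, 3, 2, 2), (-5, 1, 3, 2, 2, 3, 3, 2, 2)]

theorem sum_bil_dualFamily_smul_splitFamily (x : V) :
    ∑ i, bil (ofCoords (dualFamily i)) x • ofCoords (splitFamily i) = x := by
  have hmat : ∀ j k : Fin 9, ∑ i, (if k = 0 then 1 else -1) * ofCoords (dualFamily i) k *
      ofCoords (splitFamily i) j = if k = j then 1 else 0 := by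
    decide +kernel
  have hbil (w : V) : bil w x = ∑ k, (if k = 0 then 1 else -1) * w k * x k := by
    rw [bil_eq]
    simp [Fin.sum_univ_succ]
    ring
  ext j
  calc (∑ i, bil (ofCoords (dualFamily i)) x • ofCoords (splitFamily i)) j
      = ∑ k, (∑ i, (if k = 0 then 1 else -1) * ofCoords (dualFamily i) k *
          ofCoords (splitFamily i) j) * x k := by
        simp only [Finset.sum_apply, Pi.smul_apply, smul_eq_mul, hbil, Finset.sum_mul]
        rw [Finset.sum_comm]
        exact Finset.sum_congr rfl fun _ _ => Finset.sum_congr rfl fun _ _ => mul_right_comm _ _ _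
    _ = x j := by
        simp only [hmat]
        simp

/-- The automorphisms permuting `dualFamily` and `splitFamily` compatibly. -/
def familyAut : Submonoid LatAut where
  carrier := {g | ∃ e : Equiv.Perm (Fin 15), ∀ i,
    g (ofCoords (dualFamily i)) = ofCoords (dualFamily (e i)) ∧
    g (ofCoords (splitFamily i)) = ofCoords (splitFamily (e i))}
  one_mem' := ⟨1, fun _ => ⟨rfl, rfl⟩⟩
  mul_mem' := by
    rintro g h ⟨e, he⟩ ⟨e', he'⟩
    refine ⟨e * e', fun i => ?_⟩
    simp only [LinearEquiv.mul_apply, he', he, Equiv.Perm.mul_apply, and_self]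

theorem mem_familyAut {g : LatAut} {f : Coords → Coords} (hg : ∀ p, g (ofCoords p) = ofCoords (f p))
    (e : Fin 15 → Fin 15) (hinj : ∀ i j, e i = e j → i = j)
    (he : ∀ i, f (dualFamily i) = dualFamily (e i) ∧ f (splitFamily i) = splitFamily (e i)) :
    g ∈ familyAut :=
  ⟨Equiv.ofBijective e (Finite.injective_iff_bijective.1 fun i j => hinj i j), fun i =>
    ⟨(hg _).trans (congrArg _ (he i).1), (hg _).trans (congrArg _ (he i).2)⟩⟩

theorem genA_mem_familyAut : genA ∈ familyAut :=
  mem_familyAut (f := coordsA) (fun _ => rfl) ![0, 1, 2, 3, 4, 6, 7, 8, 9, 5, 11, 12, 13, 14, 10]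
    (by decide +kernel) (by decide +kernel)

theorem genC_mem_familyAut : genC ∈ familyAut :=
  mem_familyAut (f := coordsC) (fun _ => rfl) ![0, 4, 3, 2, 1, 10, 12, 14, 11, 13, 5, 7, 9, 6, 8]
    (by decide +kernel) (by decide +kernel)

theorem genZ_mem_familyAut : genZ ∈ familyAut :=
  mem_familyAut (f := coordsZ) (fun _ => rfl) ![0, 2, 1, 4, 3, 5, 6, 7, 8, 9, 10, 11, 12, 13, 14]
    (by decide +kernel) (by decide +kernel)

theorem condH1_dpGroup : CondH1 dpGroup := by
  intro G' hG'
  have : Finite G' := Finite.of_injective _ (Subgroup.inclusion_injective hG')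
  refine subsingleton_H1_of_permuted_families (rep G')
    (fun i => AddMonoidHom.mk' (bil (ofCoords (dualFamily i))) (bil_add_right _))
    (fun i => ofCoords (splitFamily i)) (fun g => ?_) sum_bil_dualFamily_smul_splitFamily
  obtain ⟨e, he⟩ := dpGroup_le_of_gens familyAut genA_mem_familyAut genC_mem_familyAut
    genZ_mem_familyAut (hG' g.2)
  refine ⟨e, fun i => ⟨fun x => ?_, (he i).2.symm⟩⟩
  change bil (ofCoords (dualFamily (e i))) ((g : LatAut) x) = bil (ofCoords (dualFamily i)) x
  rw [← (he i).1, (dpGroup_le_W (hG' g.2)).1]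

theorem exists_dp1_C2xF5_conic :
    ∃ G : Subgroup LatAut, G ≤ W ∧
      (∃ ψ : Multiplicative (ZMod 4) →* MulAut (Multiplicative (ZMod 5)),
        Function.Injective ψ ∧
        Nonempty (G ≃* (Multiplicative (ZMod 2) × (Multiplicative (ZMod 5) ⋊[ψ] Multiplicative (ZMod 4))))) ∧
      (orbs G).ncard = 20 ∧
      {S ∈ orbs G | S.ncard = 2}.ncard = 4 ∧
      {S ∈ orbs G | S.ncard = 4}.ncard = 3 ∧
      {S ∈ orbs G | S.ncard = 10}.ncard = 4 ∧
      {S ∈ orbs G | S.ncard = 20}.ncard = 9 ∧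
      MinimalAction G ∧
      (∃ C, IsConic C ∧ ∀ g ∈ G, g C = C) ∧
      CondH1 G := by
  refine ⟨dpGroup, dpGroup_le_W, ⟨frobeniusAction, frobeniusAction_injective,
    ⟨(MonoidHom.ofInjective c2f5Hom_injective).symm⟩⟩, ncard_orbs_dpGroup, ?_, ?_, ?_, ?_,
    minimalAction_dpGroup, exists_conic_fixed, condH1_dpGroup⟩
  all_goals
    rw [ncard_orbs_of_length]
    decide

end
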